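/- arXiv:0903.4102 — 6 statements merged into one kernel-verified Lean document; each statement's English description precedes it below -/
import Mathlib

section
/- Let φ₁, φ₂, φ₃ : ℂ → ℂ be arbitrary functions, let ε₀, ε₁, …, ε₉ ∈ ℂ, and set δ = 3ε₀ − ε₁ − ⋯ − ε₉, ω = ε₈ − ε₉, ε_{ij} = ε_i − ε_j, ε_{ijk} = ε₀ − ε_i − ε_j − ε_k. Define ν(ε₀,…,ε₉) = φ₁(ε_{79}) · ∏_{1≤i<j≤5} φ₁(ε_{ij9}) · ∏_{i=1}^{5} φ₁(δ + ω − ε_{i69}) · ∏_{i=1}^{5} φ₂(ε_{i67})·φ₂(ε_{i6}) · φ₃(ε_{667}). Then ν is invariant under every permutation of the variables ε₁, …, ε₅, and also under the substitution s₁₂₇ : ε₀ ↦ 2ε₀ − ε₁ − ε₂ − ε₇, ε₁ ↦ ε₀ − ε₂ − ε₇, ε₂ ↦ ε₀ − ε₁ − ε₇, ε₇ ↦ ε₀ − ε₁ − ε₂ (all other ε_i fixed). Consequently ν is invariant under the Weyl group W(D₅) = ⟨s₁₂, s₂₃, s₃₄, s₄₅, s₁₂₇⟩ acting on (ε₀,…,ε₉).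 -/
/-- The correction factor `ν⁽⁶⁾(ε)` built from arbitrary functions `φ₁, φ₂, φ₃`:
`ν = φ₁(ε_{79}) · ∏_{1≤i<j≤5} φ₁(ε_{ij9}) · ∏_{i=1}^{5} φ₁(δ+ω−ε_{i69})
   · ∏_{i=1}^{5} φ₂(ε_{i67})φ₂(ε_{i6}) · φ₃(ε_{667})`,
where `δ = 3ε₀ − ε₁ − ⋯ − ε₉`, `ω = ε₈ − ε₉`, `ε_{ij} = ε_i − ε_j`,
`ε_{ijk} = ε₀ − ε_i − ε_j − ε_k`. -/
noncomputable def nu (φ1 φ2 φ3 : ℂ → ℂ) (ε : ℕ → ℂ) : ℂ :=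
  φ1 (ε 7 - ε 9) *
    (∏ p ∈ (Finset.Icc 1 5 ×ˢ Finset.Icc 1 5).filter fun p => p.1 < p.2,
      φ1 (ε 0 - ε p.1 - ε p.2 - ε 9)) *
    (∏ i ∈ Finset.Icc 1 5,
      φ1 ((3 * ε 0 - ε 1 - ε 2 - ε 3 - ε 4 - ε 5 - ε 6 - ε 7 - ε 8 - ε 9) + (ε 8 - ε 9) -
        (ε 0 - ε i - ε 6 - ε 9))) *
    (∏ i ∈ Finset.Icc 1 5, (φ2 (ε 0 - ε i - ε 6 - ε 7) * φ2 (ε i - ε 6))) *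
    φ3 (ε 0 - ε 6 - ε 6 - ε 7)

/-- The substitution `s₁₂₇` on the parameters: the reflection associated with
the root `ε₁₂₇ = ε₀ − ε₁ − ε₂ − ε₇`. -/
def s127 (ε : ℕ → ℂ) : ℕ → ℂ := fun n =>
  if n = 0 then 2 * ε 0 - ε 1 - ε 2 - ε 7
  else if n = 1 then ε 0 - ε 2 - ε 7
  else if n = 2 then ε 0 - ε 1 - ε 7
  else if n = 7 then ε 0 - ε 1 - ε 2
  else ε n

/-- The substitution exchanging `ε_i` and `ε_j`. -/
def swp (i j : ℕ) (ε : ℕ → ℂ) : ℕ → ℂ := fun n => ε (Equiv.swap i j n)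

theorem prod_pairs_lt_eq_prod_powersetCard (g : Finset ℕ → ℂ) :
    (∏ p ∈ (Finset.Icc 1 5 ×ˢ Finset.Icc 1 5).filter fun p : ℕ × ℕ => p.1 < p.2,
      g {p.1, p.2}) = ∏ s ∈ Finset.powersetCard 2 (Finset.Icc 1 5), g s := by
  have himage : ((Finset.Icc 1 5 ×ˢ Finset.Icc 1 5).filter fun p : ℕ × ℕ => p.1 < p.2).image
      (fun p => ({p.1, p.2} : Finset ℕ)) = Finset.powersetCard 2 (Finset.Icc 1 5) := by
    decide
  have hinj : ∀ p ∈ (Finset.Icc 1 5 ×ˢ Finset.Icc 1 5).filter fun p : ℕ × ℕ => p.1 < p.2,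
      ∀ q ∈ (Finset.Icc 1 5 ×ˢ Finset.Icc 1 5).filter fun p : ℕ × ℕ => p.1 < p.2,
      ({p.1, p.2} : Finset ℕ) = {q.1, q.2} → p = q := by
    decide
  rw [← himage, Finset.prod_image hinj]

/-- A form of `ν⁽⁶⁾` in which every dependence on `ε₁,…,ε₅` is visibly symmetric. -/
theorem nu_eq_symmetric (φ1 φ2 φ3 : ℂ → ℂ) (ε : ℕ → ℂ) :
    nu φ1 φ2 φ3 ε = φ1 (ε 7 - ε 9) *
      (∏ s ∈ Finset.powersetCard 2 (Finset.Icc 1 5), φ1 (ε 0 - ∑ i ∈ s, ε i - ε 9)) *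
      (∏ i ∈ Finset.Icc 1 5,
        φ1 (2 * ε 0 - (∑ j ∈ Finset.Icc 1 5, ε j) + ε i - ε 7 - ε 9)) *
      (∏ i ∈ Finset.Icc 1 5, (φ2 (ε 0 - ε i - ε 6 - ε 7) * φ2 (ε i - ε 6))) *
      φ3 (ε 0 - ε 6 - ε 6 - ε 7) := by
  rw [nu, ← prod_pairs_lt_eq_prod_powersetCard fun s => φ1 (ε 0 - ∑ i ∈ s, ε i - ε 9)]
  have hsum : ∑ j ∈ Finset.Icc 1 5, ε j = ε 1 + ε 2 + ε 3 + ε 4 + ε 5 := by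
    simp [Finset.sum_Icc_succ_top]
  congr 3
  · congr 1
    refine Finset.prod_congr rfl fun p hp => ?_
    rw [Finset.sum_pair (Finset.mem_filter.mp hp).2.ne, ← sub_sub (ε 0)]
  · refine Finset.prod_congr rfl fun i _ => ?_
    rw [hsum]
    congr 1
    ring

theorem nu_comp_perm (φ1 φ2 φ3 : ℂ → ℂ) (ε : ℕ → ℂ) (σ : Equiv.Perm ℕ)
    (hσ : ∀ n, n ∉ ({1, 2, 3, 4, 5} : Set ℕ) → σ n = n) :
    nu φ1 φ2 φ3 (ε ∘ σ) = nu φ1 φ2 φ3 ε := by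
  have hIcc : (Finset.Icc 1 5).map σ.toEmbedding = Finset.Icc 1 5 := by
    refine Finset.map_perm fun n hn => ?_
    by_contra h
    refine hn (hσ n fun hmem => h ?_)
    rcases hmem with rfl | rfl | rfl | rfl | rfl <;> simp
  have hprod (g : ℕ → ℂ) : ∏ i ∈ Finset.Icc 1 5, g (σ i) = ∏ i ∈ Finset.Icc 1 5, g i := by
    conv_rhs => rw [← hIcc, Finset.prod_map]
    rfl
  have hsum : ∑ i ∈ Finset.Icc 1 5, ε (σ i) = ∑ i ∈ Finset.Icc 1 5, ε i := by
    conv_rhs => rw [← hIcc, Finset.sum_map]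
    rfl
  have hpairs : ∏ s ∈ Finset.powersetCard 2 (Finset.Icc 1 5),
        φ1 (ε 0 - ∑ i ∈ s, ε (σ i) - ε 9) =
      ∏ s ∈ Finset.powersetCard 2 (Finset.Icc 1 5), φ1 (ε 0 - ∑ i ∈ s, ε i - ε 9) := by
    conv_rhs => rw [← hIcc, Finset.powersetCard_map, Finset.prod_map]
    simp [Finset.mapEmbedding_apply]
  have h0 := hσ 0 (by simp)
  have h6 := hσ 6 (by simp)
  have h7 := hσ 7 (by simp)
  have h9 := hσ 9 (by simp)
  simp only [nu_eq_symmetric, Function.comp_apply, h0, h6, h7, h9, hsum, hpairs,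
    hprod fun i => φ1 (2 * ε 0 - (∑ j ∈ Finset.Icc 1 5, ε j) + ε i - ε 7 - ε 9),
    hprod fun i => φ2 (ε 0 - ε i - ε 6 - ε 7) * φ2 (ε i - ε 6)]

theorem nu_swp (φ1 φ2 φ3 : ℂ → ℂ) {i j : ℕ} (hi : i ∈ ({1, 2, 3, 4, 5} : Set ℕ))
    (hj : j ∈ ({1, 2, 3, 4, 5} : Set ℕ)) (ε : ℕ → ℂ) :
    nu φ1 φ2 φ3 (swp i j ε) = nu φ1 φ2 φ3 ε :=
  nu_comp_perm φ1 φ2 φ3 ε (Equiv.swap i j) fun _ hn =>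
    Equiv.swap_apply_of_ne_of_ne (fun h => hn (h ▸ hi)) fun h => hn (h ▸ hj)

theorem nu_s127 (φ1 φ2 φ3 : ℂ → ℂ) (ε : ℕ → ℂ) :
    nu φ1 φ2 φ3 (s127 ε) = nu φ1 φ2 φ3 ε := by
  have hpairs : (Finset.Icc 1 5 ×ˢ Finset.Icc 1 5).filter (fun p : ℕ × ℕ => p.1 < p.2) =
      {(1, 2), (1, 3), (1, 4), (1, 5), (2, 3), (2, 4), (2, 5), (3, 4), (3, 5), (4, 5)} := by
    decide
  have hIcc : Finset.Icc 1 5 = ({1, 2, 3, 4, 5} : Finset ℕ) := by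
    decide
  simp only [nu, hpairs]
  simp [hIcc, s127]
  ring_nf

/-- `ν⁽⁶⁾` is invariant under every permutation of `ε₁,…,ε₅`, under `s₁₂₇`, and
consequently under the Weyl group `W(D₅) = ⟨s₁₂, s₂₃, s₃₄, s₄₅, s₁₂₇⟩`
(realized as all compositions of the generators). -/
theorem nu_WD5_invariant (φ1 φ2 φ3 : ℂ → ℂ) :
    (∀ (ε : ℕ → ℂ) (σ : Equiv.Perm ℕ), (∀ n, n ∉ ({1, 2, 3, 4, 5} : Set ℕ) → σ n = n) →
      nu φ1 φ2 φ3 (ε ∘ σ) = nu φ1 φ2 φ3 ε) ∧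
    (∀ ε : ℕ → ℂ, nu φ1 φ2 φ3 (s127 ε) = nu φ1 φ2 φ3 ε) ∧
    (∀ l : List ((ℕ → ℂ) → (ℕ → ℂ)),
      (∀ f ∈ l, f = swp 1 2 ∨ f = swp 2 3 ∨ f = swp 3 4 ∨ f = swp 4 5 ∨ f = s127) →
      ∀ ε : ℕ → ℂ,
        nu φ1 φ2 φ3 (l.foldr (fun f acc => f ∘ acc) id ε) = nu φ1 φ2 φ3 ε) := by
  refine ⟨nu_comp_perm φ1 φ2 φ3, nu_s127 φ1 φ2 φ3, fun l hl ε => ?_⟩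
  induction l with
  | nil => rfl
  | cons f l ih =>
    have hf (η : ℕ → ℂ) : nu φ1 φ2 φ3 (f η) = nu φ1 φ2 φ3 η := by
      rcases hl f List.mem_cons_self with rfl | rfl | rfl | rfl | rfl
      on_goal 5 => exact nu_s127 φ1 φ2 φ3 η
      all_goals exact nu_swp φ1 φ2 φ3 (by simp) (by simp) η
    exact (hf _).trans (ih fun g hg => hl g (List.mem_cons_of_mem f hg))
end

section
/- Let ε₀, …, ε₉ ∈ ℂ with [x] = e^{iπx} − e^{−iπx}, C = {1,…,6}, L = {7,8,9}, ε_{mn} = ε_m − ε_n, ε_{mnp} = ε₀ − ε_m − ε_n − ε_p. Let A₁, …, A₉ ∈ ℂ and let B_{mn} = B_{nm} ∈ ℂ be given for every unordered pair {m,n} with m ≠ n that is not contained in L. Assume: (i) for all distinct i, j ∈ C and distinct r, s ∈ L: [ε_{rs}]·A_j·B_{ij} = [ε_{ijs}]·A_r·B_{ir} − [ε_{ijr}]·A_s·B_{is}; (ii) for all distinct i, j, k ∈ C and r ∈ L: [ε_{jk}]·A_r·B_{ir} = [ε_{ikr}]·A_j·B_{ij} − [ε_{ijr}]·A_k·B_{ik}.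 Assume further that A_m ≠ 0 for all m ∈ {1,…,9}, [ε_{rs}] ≠ 0 for all distinct r, s ∈ L, and [ε_{ij}] ≠ 0 for all distinct i, j ∈ C. Then: (C1) for all distinct i, j, k ∈ C and r ∈ L: [ε_{ij}][ε_{ijr}]·A_k·B_{kr} + [ε_{jk}][ε_{jkr}]·A_i·B_{ir} + [ε_{ki}][ε_{kir}]·A_j·B_{jr} = 0; and (C2) for all distinct i, j, k, l ∈ C: [ε_{ij}][ε_{kl}]·B_{ij}·B_{kl} + [ε_{jk}][ε_{il}]·B_{jk}·B_{il} + [ε_{ki}][ε_{jl}]·B_{ki}·B_{jl} = 0. -/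
/-- The trigonometric building block `[t] = e^{iπt} − e^{−iπt} = 2i·sin(πt)`. -/
noncomputable def br (t : ℂ) : ℂ :=
  Complex.exp (Real.pi * Complex.I * t) - Complex.exp (-(Real.pi * Complex.I * t))

/-- The index set `C = {1,…,6}` (points on the conic). -/
def Cset : Set ℕ := {1, 2, 3, 4, 5, 6}

/-- The index set `L = {7,8,9}` (points on the line). -/
def Lset : Set ℕ := {7, 8, 9}

lemma br_sub_comm (a b : ℂ) : br (a - b) = -br (b - a) := by
  simp only [br, mul_sub, neg_sub]

/-- The three-term identity for `br`. -/
lemma br_three_term (x a b c : ℂ) :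
    br (b - c) * br (x - a) + br (c - a) * br (x - b) + br (a - b) * br (x - c) = 0 := by
  simp only [br, mul_sub, neg_sub, Complex.exp_sub]
  field_simp
  ring

lemma Cset.bounds {m : ℕ} (hm : m ∈ Cset) : 1 ≤ m ∧ m ≤ 9 := by
  simp only [Cset, Set.mem_insert_iff, Set.mem_singleton_iff] at hm
  omega

lemma Lset.bounds {m : ℕ} (hm : m ∈ Lset) : 1 ≤ m ∧ m ≤ 9 := by
  simp only [Lset, Set.mem_insert_iff, Set.mem_singleton_iff] at hm
  omega

lemma Cset.notMem_Lset {m : ℕ} (hm : m ∈ Cset) : m ∉ Lset := by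
  simp only [Cset, Lset, Set.mem_insert_iff, Set.mem_singleton_iff] at *
  omega

/-- The bilinear equations (bi_1) imply the bilinear equations (bi_2):
here `A m` stands for `τ_{e_m}` and `B m n` for `τ_{e₀−e_m−e_n}`. -/
theorem bi1_implies_bi2 (ε : ℕ → ℂ) (A : ℕ → ℂ) (B : ℕ → ℕ → ℂ)
    (hBsymm : ∀ m n : ℕ, m ≠ n → ¬(m ∈ Lset ∧ n ∈ Lset) → B m n = B n m)
    (hbi1a : ∀ i j r s : ℕ, i ∈ Cset → j ∈ Cset → i ≠ j → r ∈ Lset → s ∈ Lset → r ≠ s →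
      br (ε r - ε s) * A j * B i j =
        br (ε 0 - ε i - ε j - ε s) * A r * B i r -
          br (ε 0 - ε i - ε j - ε r) * A s * B i s)
    (hbi1b : ∀ i j k r : ℕ, i ∈ Cset → j ∈ Cset → k ∈ Cset →
      i ≠ j → j ≠ k → i ≠ k → r ∈ Lset →
      br (ε j - ε k) * A r * B i r =
        br (ε 0 - ε i - ε k - ε r) * A j * B i j -
          br (ε 0 - ε i - ε j - ε r) * A k * B i k)
    (hA : ∀ m : ℕ, 1 ≤ m → m ≤ 9 → A m ≠ 0)
    (hrs : ∀ r s : ℕ, r ∈ Lset → s ∈ Lset → r ≠ s → br (ε r - ε s) ≠ 0)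
    (hij : ∀ i j : ℕ, i ∈ Cset → j ∈ Cset → i ≠ j → br (ε i - ε j) ≠ 0) :
    (∀ i j k r : ℕ, i ∈ Cset → j ∈ Cset → k ∈ Cset →
      i ≠ j → j ≠ k → i ≠ k → r ∈ Lset →
      br (ε i - ε j) * br (ε 0 - ε i - ε j - ε r) * A k * B k r +
        br (ε j - ε k) * br (ε 0 - ε j - ε k - ε r) * A i * B i r +
          br (ε k - ε i) * br (ε 0 - ε k - ε i - ε r) * A j * B j r = 0) ∧
    (∀ i j k l : ℕ, i ∈ Cset → j ∈ Cset → k ∈ Cset → l ∈ Cset →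
      i ≠ j → i ≠ k → i ≠ l → j ≠ k → j ≠ l → k ≠ l →
      br (ε i - ε j) * br (ε k - ε l) * B i j * B k l +
        br (ε j - ε k) * br (ε i - ε l) * B j k * B i l +
          br (ε k - ε i) * br (ε j - ε l) * B k i * B j l = 0) := by
  have hAC : ∀ m ∈ Cset, A m ≠ 0 := fun m hm => hA m (Cset.bounds hm).1 (Cset.bounds hm).2
  have hsymm : ∀ i j : ℕ, i ∈ Cset → i ≠ j → B j i = B i j := fun i j hi h =>
    (hBsymm i j h fun h' => Cset.notMem_Lset hi h'.1).symm
  refine ⟨fun i j k r hi hj hk hij' hjk hik hr => ?_,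
    fun i j k l hi hj hk hl hij' hik hil hjk hjl hkl => ?_⟩
  · refine (mul_eq_zero_iff_left (hA r (Lset.bounds hr).1 (Lset.bounds hr).2)).mp ?_
    have h₁ := hbi1b i j k r hi hj hk hij' hjk hik hr
    have h₂ := hbi1b j k i r hj hk hi hjk hik.symm hij'.symm hr
    have h₃ := hbi1b k i j r hk hi hj hik.symm hij' hjk.symm hr
    rw [hsymm i j hi hij', sub_right_comm (ε 0) (ε j) (ε i)] at h₂
    rw [hsymm i k hi hik, hsymm j k hj hjk, sub_right_comm (ε 0) (ε k) (ε j),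
      sub_right_comm (ε 0) (ε k) (ε i)] at h₃
    rw [sub_right_comm (ε 0) (ε k) (ε i)]
    linear_combination br (ε 0 - ε j - ε k - ε r) * A i * h₁ +
      br (ε 0 - ε i - ε k - ε r) * A j * h₂ + br (ε 0 - ε i - ε j - ε r) * A k * h₃
  · have three : ∀ i j k l : ℕ, i ∈ Cset → j ∈ Cset → k ∈ Cset → l ∈ Cset →
        i ≠ j → i ≠ k → i ≠ l →
        br (ε k - ε l) * A j * B i j + br (ε l - ε j) * A k * B i k +
          br (ε j - ε k) * A l * B i l = 0 := by
      intro i j k l hi hj hk hl hij' hik hil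
      have h7 : 7 ∈ Lset := by simp [Lset]
      have h8 : 8 ∈ Lset := by simp [Lset]
      refine (mul_eq_zero_iff_left (hrs 7 8 h7 h8 (by norm_num))).mp ?_
      have e₁ := hbi1a i j 7 8 hi hj hij' h7 h8 (by norm_num)
      have e₂ := hbi1a i k 7 8 hi hk hik h7 h8 (by norm_num)
      have e₃ := hbi1a i l 7 8 hi hl hil h7 h8 (by norm_num)
      have t₇ := br_three_term (ε 0 - ε i - ε 7) (ε j) (ε k) (ε l)
      have t₈ := br_three_term (ε 0 - ε i - ε 8) (ε j) (ε k) (ε l)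
      simp only [sub_right_comm (ε 0 - ε i) (ε 7), sub_right_comm (ε 0 - ε i) (ε 8)] at t₇ t₈
      linear_combination br (ε k - ε l) * e₁ + br (ε l - ε j) * e₂ + br (ε j - ε k) * e₃ +
        A 7 * B i 7 * t₈ - A 8 * B i 8 * t₇
    have hi₃ := three i j k l hi hj hk hl hij' hik hil
    have hk₃ := three k i j l hk hi hj hl hik.symm hjk.symm hkl
    have hl₃ := three l i j k hl hi hj hk hil.symm hjl.symm hkl.symm
    rw [hsymm i k hi hik, hsymm j k hj hjk, br_sub_comm (ε l)] at hk₃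
    rw [hsymm i l hi hil, hsymm j l hj hjl, hsymm k l hk hkl] at hl₃
    rw [br_sub_comm (ε l)] at hi₃
    rw [hsymm i k hi hik]
    refine (mul_eq_zero_iff_left (mul_ne_zero (mul_ne_zero (hAC i hi) (hAC j hj))
      (mul_ne_zero (hAC k hk) (hAC l hl)))).mp ?_
    linear_combination A i * A k * A l * br (ε i - ε j) * B k l * hi₃ +
      A i * A k * A l * br (ε j - ε l) * B i k * hl₃ -
      A i * A k * A l * br (ε j - ε k) * B i l * hk₃
end

section
/- Let ε₀, …, ε₉ ∈ ℂ with [x] = e^{iπx} − e^{−iπx}, C = {1,…,6}, ε_{mn} = ε_m − ε_n, ε_{mnp} = ε₀ − ε_m − ε_n − ε_p. Let A ∈ ℂ, let D_k ∈ ℂ (k ∈ C), let B_{ij} = B_{ji} ∈ ℂ for distinct i, j ∈ C, and let E_{ijk} ∈ ℂ be symmetric in the distinct indices i, j, k ∈ C. Suppose that for all distinct i, j, k ∈ C: [ε_{jk}]·A·E_{ijk} = [ε_{ik8}]·D_k·B_{ij} − [ε_{ij8}]·D_j·B_{ik} (the bilinear equations of type (C)ⁱ₀), and assume [ε_{ij8}]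 ≠ 0 for all distinct i, j ∈ C. Then for all distinct i, j, k ∈ C: [ε_{ij}]·B_{ij}·D_k + [ε_{jk}]·B_{jk}·D_i + [ε_{ki}]·B_{ki}·D_j = 0 (the bilinear equations of type (C)ʳ₀). -/
theorem br_mul_br (s t : ℂ) :
    br s * br t =
      Complex.exp (Real.pi * Complex.I * (s + t)) + Complex.exp (-(Real.pi * Complex.I * (s + t))) -
        (Complex.exp (Real.pi * Complex.I * (s - t)) +
          Complex.exp (-(Real.pi * Complex.I * (s - t)))) := by
  simp only [br, sub_mul, mul_sub, ← Complex.exp_add]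
  ring_nf

/-- The products `[x - y][s - x - y]`, summed cyclically over `x, y, z`, telescope to zero. -/
theorem br_cyclic_sum (s x y z : ℂ) :
    br (x - y) * br (s - x - y) + br (y - z) * br (s - y - z) +
      br (z - x) * br (s - x - z) = 0 := by
  simp only [br_mul_br]
  ring_nf

/-- The bilinear equations of type (C)ⁱ₀ imply those of type (C)ʳ₀:
here `A` stands for `τ_{e₈}`, `D k` for `τ_{e₀−e_k−e₉}`, `B i j` for
`τ_{e₀−e_i−e_j}`, and `E i j k` for `τ_{2e₀−e_i−e_j−e_k−e₈−e₉}`. -/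
theorem Ci0_implies_Cr0 (ε : ℕ → ℂ) (A : ℂ) (D : ℕ → ℂ) (B : ℕ → ℕ → ℂ)
    (E : ℕ → ℕ → ℕ → ℂ)
    (hBsymm : ∀ i j : ℕ, i ∈ Cset → j ∈ Cset → i ≠ j → B i j = B j i)
    (hEsymm : ∀ i j k : ℕ, i ∈ Cset → j ∈ Cset → k ∈ Cset → i ≠ j → j ≠ k → i ≠ k →
      E i j k = E j i k ∧ E i j k = E i k j)
    (hCi0 : ∀ i j k : ℕ, i ∈ Cset → j ∈ Cset → k ∈ Cset → i ≠ j → j ≠ k → i ≠ k →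
      br (ε j - ε k) * A * E i j k =
        br (ε 0 - ε i - ε k - ε 8) * D k * B i j -
          br (ε 0 - ε i - ε j - ε 8) * D j * B i k)
    (h8 : ∀ i j : ℕ, i ∈ Cset → j ∈ Cset → i ≠ j → br (ε 0 - ε i - ε j - ε 8) ≠ 0) :
    ∀ i j k : ℕ, i ∈ Cset → j ∈ Cset → k ∈ Cset → i ≠ j → j ≠ k → i ≠ k →
      br (ε i - ε j) * B i j * D k + br (ε j - ε k) * B j k * D i +
        br (ε k - ε i) * B k i * D j = 0 := by
  intro i j k hi hj hk hij hjk hik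
  obtain ⟨hE₁, hE₂⟩ := hEsymm i j k hi hj hk hij hjk hik
  have hE : E j k i = E i j k :=
    (hEsymm j k i hj hk hi hjk hik.symm hij.symm).2.trans hE₁.symm
  have hi_eq := hCi0 i j k hi hj hk hij hjk hik
  have hj_eq := hCi0 j k i hj hk hi hjk hik.symm hij.symm
  rw [hE, hBsymm j i hj hi hij.symm, sub_right_comm (ε 0) (ε j) (ε i)] at hj_eq
  rw [hBsymm k i hk hi hik.symm]
  have hbr := br_cyclic_sum (ε 0 - ε 8) (ε i) (ε j) (ε k)
  simp only [sub_right_comm _ (ε 8)] at hbr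
  refine (mul_eq_zero.mp ?_).resolve_left (h8 i j hi hj hij)
  linear_combination D k * B i j * hbr + br (ε k - ε i) * hi_eq - br (ε j - ε k) * hj_eq
end

section
/- Let ε₀, …, ε₉ ∈ ℂ with [x] = e^{iπx} − e^{−iπx}, C = {1,…,6}, ε_{mn} = ε_m − ε_n, ε_{mnp} = ε₀ − ε_m − ε_n − ε_p. Let A₈, A₉ ∈ ℂ, A_m ∈ ℂ (m ∈ C), B_{ij} = B_{ji} ∈ ℂ (i, j ∈ C distinct), D_{i8}, D_{i9} ∈ ℂ (i ∈ C), and E_{ijk} ∈ ℂ symmetric in the distinct indices i, j, k ∈ C. Suppose: (i) for all distinct i, j, k ∈ C: [ε_{jk}]·A₉·E_{ijk} = [ε_{ik9}]·D_{k8}·B_{ij} − [ε_{ij9}]·D_{j8}·B_{ik} (type (C)ⁱ₋₁); (ii) for all distinct i, j ∈ C: [ε_{89}]·A_j·B_{ij} = [ε_{ij9}]·A₈·D_{i8} − [ε_{ij8}]·A₉·D_{i9} (type (A)₀); and (iii) A₉ ≠ 0. Then for all distinct i, j, k ∈ C: [ε_{jk}]·A₈·E_{ijk} = [ε_{ik8}]·D_{k9}·B_{ij}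 − [ε_{ij8}]·D_{j9}·B_{ik} (type (C)ⁱ₀). -/
/-- The bilinear equations of types (A)₀ and (C)ⁱ₋₁ imply those of type (C)ⁱ₀ when
`τ_{e₉} ≠ 0`: here `A8, A9, A m` stand for `τ_{e₈}, τ_{e₉}, τ_{e_m}`; `B i j` for
`τ_{e₀−e_i−e_j}`; `D i r` for `τ_{e₀−e_i−e_r}`; and `E i j k` for
`τ_{2e₀−e_i−e_j−e_k−e₈−e₉}`. -/
theorem A0_Cim1_implies_Ci0 (ε : ℕ → ℂ) (A8 A9 : ℂ) (A : ℕ → ℂ)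
    (B : ℕ → ℕ → ℂ) (D : ℕ → ℕ → ℂ) (E : ℕ → ℕ → ℕ → ℂ)
    (hBsymm : ∀ i j : ℕ, i ∈ Cset → j ∈ Cset → i ≠ j → B i j = B j i)
    (hEsymm : ∀ i j k : ℕ, i ∈ Cset → j ∈ Cset → k ∈ Cset → i ≠ j → j ≠ k → i ≠ k →
      E i j k = E j i k ∧ E i j k = E i k j)
    (hCim1 : ∀ i j k : ℕ, i ∈ Cset → j ∈ Cset → k ∈ Cset → i ≠ j → j ≠ k → i ≠ k →
      br (ε j - ε k) * A9 * E i j k =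
        br (ε 0 - ε i - ε k - ε 9) * D k 8 * B i j -
          br (ε 0 - ε i - ε j - ε 9) * D j 8 * B i k)
    (hA0 : ∀ i j : ℕ, i ∈ Cset → j ∈ Cset → i ≠ j →
      br (ε 8 - ε 9) * A j * B i j =
        br (ε 0 - ε i - ε j - ε 9) * A8 * D i 8 -
          br (ε 0 - ε i - ε j - ε 8) * A9 * D i 9)
    (hA9 : A9 ≠ 0) :
    ∀ i j k : ℕ, i ∈ Cset → j ∈ Cset → k ∈ Cset → i ≠ j → j ≠ k → i ≠ k →
      br (ε j - ε k) * A8 * E i j k =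
        br (ε 0 - ε i - ε k - ε 8) * D k 9 * B i j -
          br (ε 0 - ε i - ε j - ε 8) * D j 9 * B i k := by
  intro i j k hi hj hk hij hjk hik
  have hk0 := hA0 k i hk hi hik.symm
  have hj0 := hA0 j i hj hi hij.symm
  rw [hBsymm k i hk hi hik.symm, sub_right_comm (ε 0)] at hk0
  rw [hBsymm j i hj hi hij.symm, sub_right_comm (ε 0)] at hj0
  apply mul_left_cancel₀ hA9
  linear_combination A8 * hCim1 i j k hi hj hk hij hjk hik - B i j * hk0 + B i k * hj0
end

section
/- Let δ ∈ ℂ and Ψ : ℂ⁴ → ℂ be arbitrary, and for integer shifts write Ψ(m₁,m₂,m₃,m₄)(x) = Ψ(x₁+m₁δ, x₂+m₂δ, x₃+m₃δ, x₄+m₄δ). Define K_n : ℂ⁴ → ℂ (n ≥ 0) by K₀ ≡ 1 and, for m ≥ 1, by the two-directional Casorati determinant formulas: K_{2m} evaluated at (x₁ + (2m−1)δ/4 − (m−1)δ, …, x₄ + (2m−1)δ/4 − (m−1)δ) equals det( Ψ(b−m, m+1−b, a−m, m+1−a)(x) )_{a,b=1}^{2m}, and K_{2m+1} evaluated at (x₁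 + mδ/2 − mδ, …, x₄ + mδ/2 − mδ) equals det( Ψ(b−m−1, m+1−b, a−m−1, m+1−a)(x) )_{a,b=1}^{2m+1} (in particular K₁ = Ψ). Then for every n ≥ 1 and every x ∈ ℂ⁴: K_{n+1}(x₁, x₂, x₃, x₄) · K_{n−1}(x₁+δ/2, x₂+δ/2, x₃+δ/2, x₄+δ/2) = K_n(x₁−δ/4, x₂+3δ/4, x₃−δ/4, x₄+3δ/4) · K_n(x₁+3δ/4, x₂−δ/4, x₃+3δ/4, x₄−δ/4) − K_n(x₁+3δ/4, x₂−δ/4, x₃−δ/4, x₄+3δ/4) · K_n(x₁−δ/4, x₂+3δ/4, x₃+3δ/4, x₄−δ/4). -/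
namespace Matrix

/-- Jacobi's complementary minor formula for a leading principal block of the adjugate,
multiplied by the determinant. -/
theorem det_mul_det_toBlocks₁₁_adjugate {m n R : Type*} [Fintype m] [Fintype n] [DecidableEq m]
    [DecidableEq n] [CommRing R] (M : Matrix (m ⊕ n) (m ⊕ n) R) :
    M.det * M.adjugate.toBlocks₁₁.det = M.det ^ Fintype.card m * M.toBlocks₂₂.det := by
  have h : M * fromBlocks M.adjugate.toBlocks₁₁ 0 M.adjugate.toBlocks₂₁ 1 =
      fromBlocks (M.det • (1 : Matrix m m R)) M.toBlocks₁₂ 0 M.toBlocks₂₂ := by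
    have hadj := M.mul_adjugate
    rw [← fromBlocks_toBlocks M.adjugate, ← fromBlocks_toBlocks M, fromBlocks_multiply,
      fromBlocks_toBlocks M, ← fromBlocks_one, fromBlocks_smul, fromBlocks_inj] at hadj
    obtain ⟨h₁₁, -, h₂₁, -⟩ := hadj
    conv_lhs => rw [← fromBlocks_toBlocks M]
    rw [fromBlocks_multiply, fromBlocks_toBlocks M, h₁₁, h₂₁]
    simp
  have hdet := congrArg det h
  rwa [det_mul, det_fromBlocks_zero₁₂, det_fromBlocks_zero₂₁, det_one, mul_one, det_smul,
    det_one, mul_one] at hdet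

/-- The **Desnanot–Jacobi identity**, multiplied by the determinant. -/
theorem det_mul_desnanot_jacobi {R : Type*} [CommRing R] {k : ℕ}
    (M : Matrix (Fin (k + 2)) (Fin (k + 2)) R) :
    M.det * ((M.submatrix Fin.castSucc Fin.castSucc).det * (M.submatrix Fin.succ Fin.succ).det -
        (M.submatrix Fin.castSucc Fin.succ).det * (M.submatrix Fin.succ Fin.castSucc).det) =
      M.det * (M.det * (M.submatrix (fun i : Fin k => i.castSucc.succ)
        (fun i : Fin k => i.castSucc.succ)).det) := by
  let f : Fin 2 ⊕ Fin k → Fin (k + 2) := Sum.elim ![0, Fin.last (k + 1)] fun i => i.castSucc.succ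
  have hf : Function.Bijective f := by
    rw [Fintype.bijective_iff_injective_and_card]
    refine ⟨?_, by simp [add_comm]⟩
    rintro (i | i) (j | j) h
    · fin_cases i <;> fin_cases j <;> simp_all [f, Fin.ext_iff]
    · have := j.isLt
      fin_cases i <;> simp [f, Fin.ext_iff] at h
      omega
    · have := i.isLt
      fin_cases j <;> simp [f, Fin.ext_iff] at h
      omega
    · simpa [f, Fin.ext_iff] using h
  let e := Equiv.ofBijective f hf
  have key := det_mul_det_toBlocks₁₁_adjugate (M.submatrix e e)
  have hsign : ((-1 : R) ^ (k + 1)) * (-1) ^ (k + 1) = 1 := by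
    rw [← mul_pow]; simp
  have hX : (M.submatrix e e).adjugate.toBlocks₁₁.det =
      (M.submatrix Fin.castSucc Fin.castSucc).det * (M.submatrix Fin.succ Fin.succ).det -
        (M.submatrix Fin.castSucc Fin.succ).det * (M.submatrix Fin.succ Fin.castSucc).det := by
    rw [adjugate_submatrix_equiv_self, det_fin_two]
    simp only [toBlocks₁₁, of_apply, submatrix_apply, e, f, Equiv.ofBijective_apply, Sum.elim_inl,
      cons_val_zero, cons_val_one, adjugate_fin_succ_eq_det_submatrix, Fin.val_zero, Fin.val_last,
      Fin.succAbove_zero, Fin.succAbove_last, pow_add _ (k + 1), add_zero, zero_add, pow_zero]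
    linear_combination ((M.submatrix Fin.castSucc Fin.castSucc).det *
      (M.submatrix Fin.succ Fin.succ).det - (M.submatrix Fin.castSucc Fin.succ).det *
      (M.submatrix Fin.succ Fin.castSucc).det) * hsign
  rw [hX, det_submatrix_equiv_self, Fintype.card_fin, sq, mul_assoc] at key
  exact key

/-- The **Desnanot–Jacobi identity** (Dodgson condensation). -/
theorem desnanot_jacobi {R : Type*} [CommRing R] {k : ℕ}
    (M : Matrix (Fin (k + 2)) (Fin (k + 2)) R) :
    M.det * (M.submatrix (fun i : Fin k => i.castSucc.succ)
        (fun i : Fin k => i.castSucc.succ)).det =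
      (M.submatrix Fin.castSucc Fin.castSucc).det * (M.submatrix Fin.succ Fin.succ).det -
        (M.submatrix Fin.castSucc Fin.succ).det * (M.submatrix Fin.succ Fin.castSucc).det := by
  have generic := mul_left_cancel₀ (det_mvPolynomialX_ne_zero (Fin (k + 2)) ℤ)
    (det_mul_desnanot_jacobi (mvPolynomialX (Fin (k + 2)) (Fin (k + 2)) ℤ))
  let φ := MvPolynomial.eval₂Hom (Int.castRingHom R) fun p : Fin (k + 2) × Fin (k + 2) => M p.1 p.2
  have hφ : (mvPolynomialX (Fin (k + 2)) (Fin (k + 2)) ℤ).map φ = M := by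
    ext i j
    simp [φ]
  have h := congrArg φ generic
  simp only [map_sub, map_mul, RingHom.map_det, RingHom.mapMatrix_apply, ← submatrix_map, hφ] at h
  exact h.symm

end Matrix


/-- The Jacobi (Dodgson condensation) identity for the two-directional Casorati
determinants `K_n` built from an arbitrary function `Ψ` of four complex variables:
`K₀ ≡ 1`, and for `m ≥ 1` the determinant formulas pin down `K_{2m}` and `K_{2m+1}`
(in particular `K₁ = Ψ`); then for every `n ≥ 1` the bilinear condensation
relation holds. -/
theorem casorati_jacobi (δ : ℂ) (Ψ : ℂ → ℂ → ℂ → ℂ → ℂ)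
    (K : ℕ → ℂ → ℂ → ℂ → ℂ → ℂ)
    (hK0 : ∀ x1 x2 x3 x4 : ℂ, K 0 x1 x2 x3 x4 = 1)
    (hKeven : ∀ m : ℕ, 1 ≤ m → ∀ x1 x2 x3 x4 : ℂ,
      K (2 * m) (x1 + (2 * (m : ℂ) - 1) * δ / 4 - ((m : ℂ) - 1) * δ)
          (x2 + (2 * (m : ℂ) - 1) * δ / 4 - ((m : ℂ) - 1) * δ)
          (x3 + (2 * (m : ℂ) - 1) * δ / 4 - ((m : ℂ) - 1) * δ)
          (x4 + (2 * (m : ℂ) - 1) * δ / 4 - ((m : ℂ) - 1) * δ) =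
        Matrix.det (Matrix.of fun a b : Fin (2 * m) =>
          Ψ (x1 + (((b : ℕ) : ℂ) + 1 - (m : ℂ)) * δ)
            (x2 + ((m : ℂ) + 1 - (((b : ℕ) : ℂ) + 1)) * δ)
            (x3 + (((a : ℕ) : ℂ) + 1 - (m : ℂ)) * δ)
            (x4 + ((m : ℂ) + 1 - (((a : ℕ) : ℂ) + 1)) * δ)))
    (hKodd : ∀ m : ℕ, ∀ x1 x2 x3 x4 : ℂ,
      K (2 * m + 1) (x1 + (m : ℂ) * δ / 2 - (m : ℂ) * δ)
          (x2 + (m : ℂ) * δ / 2 - (m : ℂ) * δ)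
          (x3 + (m : ℂ) * δ / 2 - (m : ℂ) * δ)
          (x4 + (m : ℂ) * δ / 2 - (m : ℂ) * δ) =
        Matrix.det (Matrix.of fun a b : Fin (2 * m + 1) =>
          Ψ (x1 + (((b : ℕ) : ℂ) + 1 - ((m : ℂ) + 1)) * δ)
            (x2 + ((m : ℂ) + 1 - (((b : ℕ) : ℂ) + 1)) * δ)
            (x3 + (((a : ℕ) : ℂ) + 1 - ((m : ℂ) + 1)) * δ)
            (x4 + ((m : ℂ) + 1 - (((a : ℕ) : ℂ) + 1)) * δ))) :
    ∀ n : ℕ, 1 ≤ n → ∀ x1 x2 x3 x4 : ℂ,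
      K (n + 1) x1 x2 x3 x4 *
          K (n - 1) (x1 + δ / 2) (x2 + δ / 2) (x3 + δ / 2) (x4 + δ / 2) =
        K n (x1 - δ / 4) (x2 + 3 * δ / 4) (x3 - δ / 4) (x4 + 3 * δ / 4) *
            K n (x1 + 3 * δ / 4) (x2 - δ / 4) (x3 + 3 * δ / 4) (x4 - δ / 4) -
          K n (x1 + 3 * δ / 4) (x2 - δ / 4) (x3 - δ / 4) (x4 + 3 * δ / 4) *
            K n (x1 - δ / 4) (x2 + 3 * δ / 4) (x3 + 3 * δ / 4) (x4 - δ / 4) := by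
  have hK : ∀ n : ℕ, ∀ y1 y2 y3 y4 : ℂ, K n y1 y2 y3 y4 =
      Matrix.det (Matrix.of fun a b : Fin n =>
        Ψ (y1 - ((n : ℂ) - 1) * δ / 4 + ((b : ℕ) : ℂ) * δ)
          (y2 + 3 * ((n : ℂ) - 1) * δ / 4 - ((b : ℕ) : ℂ) * δ)
          (y3 - ((n : ℂ) - 1) * δ / 4 + ((a : ℕ) : ℂ) * δ)
          (y4 + 3 * ((n : ℂ) - 1) * δ / 4 - ((a : ℕ) : ℂ) * δ)) := by
    intro n y1 y2 y3 y4
    obtain ⟨m, rfl | rfl⟩ := n.even_or_odd'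
    · rcases Nat.eq_zero_or_pos m with rfl | hm
      · exact (hK0 y1 y2 y3 y4).trans Matrix.det_fin_zero.symm
      · let c : ℂ := (2 * (m : ℂ) - 1) * δ / 4 - ((m : ℂ) - 1) * δ
        convert hKeven m hm (y1 - c) (y2 - c) (y3 - c) (y4 - c) using 6 <;>
          simp only [c] <;> push_cast <;> ring
    · let c : ℂ := (m : ℂ) * δ / 2 - (m : ℂ) * δ
      convert hKodd m (y1 - c) (y2 - c) (y3 - c) (y4 - c) using 6 <;>
        simp only [c] <;> push_cast <;> ring
  intro n hn x1 x2 x3 x4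
  obtain ⟨k, rfl⟩ := Nat.exists_eq_add_of_le' hn
  rw [Nat.add_sub_cancel]
  simp only [hK]
  convert Matrix.desnanot_jacobi (Matrix.of fun a b : Fin (k + 2) =>
    Ψ (x1 - ((k : ℂ) + 1) * δ / 4 + ((b : ℕ) : ℂ) * δ)
      (x2 + 3 * ((k : ℂ) + 1) * δ / 4 - ((b : ℕ) : ℂ) * δ)
      (x3 - ((k : ℂ) + 1) * δ / 4 + ((a : ℕ) : ℂ) * δ)
      (x4 + 3 * ((k : ℂ) + 1) * δ / 4 - ((a : ℕ) : ℂ) * δ)) using 4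
  all_goals
    ext a b
    simp -failIfUnchanged only [Matrix.of_apply, Matrix.submatrix_apply, Fin.val_succ,
      Fin.val_castSucc]
    congr 1 <;> push_cast <;> ring
end

section
/- Let L = ℤ¹⁰ with basis e₀, …, e₉ and the symmetric bilinear form ⟨e₀,e₀⟩ = −1, ⟨e_i,e_i⟩ = 1 (1 ≤ i ≤ 9), ⟨e_i,e_j⟩ = 0 (i ≠ j); write e_{ij} = e_i − e_j, e_{ijk} = e₀ − e_i − e_j − e_k (these have ⟨v,v⟩ = 2), s_v(Λ) = Λ − ⟨v,Λ⟩·v, s_{ij} = s_{e_{ij}}, s_{ijk} = s_{e_{ijk}}, c = 3e₀ − e₁ − ⋯ − e₉, and T_h(Λ) = Λ + ⟨c,Λ⟩·h − ((⟨h,h⟩/2)·⟨c,Λ⟩ + ⟨h,Λ⟩)·c for ⟨c,h⟩ = 0. Then: (i) whenever {i, j, l₁, …, l₇} = {1,…,9}, the composition s_{il₁l₂} ∘ s_{il₃l₄} ∘ s_{l₅l₆l₇} ∘ s_{il₃l₄} ∘ s_{il₁l₂} ∘ s_{ij} equals the translation T_{e_i − e_j}; and (ii) whenever {i, j, k, l₁,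 …, l₆} = {1,…,9}, the composition s_{l₁l₂l₃} ∘ s_{l₄l₅l₆} ∘ s_{l₁l₂l₃} ∘ s_{ijk} equals the translation T_{e_{ijk}}. -/
/-- The symmetric bilinear form on `L = ℤ¹⁰` with `⟨e₀,e₀⟩ = −1`, `⟨e_i,e_i⟩ = 1`
(`1 ≤ i ≤ 9`) and `⟨e_i,e_j⟩ = 0` (`i ≠ j`). -/
def form (x y : Fin 10 → ℤ) : ℤ := (∑ i, x i * y i) - 2 * (x 0 * y 0)

/-- The basis vector `e_i`. -/
def ee (i : Fin 10) : Fin 10 → ℤ := fun j => if j = i then 1 else 0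

/-- The root `e_{ij} = e_i − e_j`. -/
def eij (i j : Fin 10) : Fin 10 → ℤ := ee i - ee j

/-- The root `e_{ijk} = e₀ − e_i − e_j − e_k`. -/
def eijk (i j k : Fin 10) : Fin 10 → ℤ := ee 0 - ee i - ee j - ee k

/-- The reflection `s_v(Λ) = Λ − ⟨v,Λ⟩·v`. -/
def sRef (v Λ : Fin 10 → ℤ) : Fin 10 → ℤ := Λ - form v Λ • v

/-- The canonical central element `c = 3e₀ − e₁ − ⋯ − e₉`. -/
def cvec : Fin 10 → ℤ := fun i => if i = 0 then 3 else -1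

/-- The translation operator
`T_h(Λ) = Λ + ⟨c,Λ⟩·h − ((⟨h,h⟩/2)·⟨c,Λ⟩ + ⟨h,Λ⟩)·c` for `⟨c,h⟩ = 0`. -/
def T (h Λ : Fin 10 → ℤ) : Fin 10 → ℤ :=
  Λ + form cvec Λ • h - (form h h / 2 * form cvec Λ + form h Λ) • cvec

theorem form_comm (x y : Fin 10 → ℤ) : form x y = form y x := by
  simp only [form, mul_comm]

theorem form_add_left (x y z : Fin 10 → ℤ) : form (x + y) z = form x z + form y z := by
  simp only [form, Pi.add_apply, add_mul, Finset.sum_add_distrib]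
  ring

theorem form_smul_left (a : ℤ) (x y : Fin 10 → ℤ) : form (a • x) y = a * form x y := by
  simp only [form, Pi.smul_apply, smul_eq_mul, mul_assoc, ← Finset.mul_sum]
  ring

theorem form_sub_left (x y z : Fin 10 → ℤ) : form (x - y) z = form x z - form y z := by
  simp only [form, Pi.sub_apply, sub_mul, Finset.sum_sub_distrib]
  ring

theorem form_sub_right (x y z : Fin 10 → ℤ) : form x (y - z) = form x y - form x z := by
  rw [form_comm, form_sub_left, form_comm y, form_comm z]

theorem form_smul_right (a : ℤ) (x y : Fin 10 → ℤ) : form x (a • y) = a * form x y := by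
  rw [form_comm, form_smul_left, form_comm y]

theorem form_ee (i j : Fin 10) :
    form (ee i) (ee j) = if i = j then (if i = 0 then -1 else 1) else 0 := by
  revert i j
  decide

/-- Conjugating the reflection in `v` by the reflection in a root `u` gives the reflection
in `s_u(v)`. -/
theorem sRef_conj {u : Fin 10 → ℤ} (hu : form u u = 2) (v Λ : Fin 10 → ℤ) :
    sRef u (sRef v (sRef u Λ)) = sRef (sRef u v) Λ := by
  simp only [sRef, form_sub_right, form_sub_left, form_smul_right, form_smul_left, hu,
    form_comm v u]
  module

/-- For roots `u`, `v` with `⟨u,v⟩ = −1`, the reflection `s_u(v)` is the root `u + v`. -/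
theorem sRef_eq_add {u v : Fin 10 → ℤ} (h : form u v = -1) : sRef u v = u + v := by
  simp only [sRef, h]
  module

/-- The translation along a root `h` is the product of the reflections in `c − h` and `h`. -/
theorem sRef_cvec_sub {h : Fin 10 → ℤ} (hh : form h h = 2) (hc : form cvec h = 0)
    (Λ : Fin 10 → ℤ) : sRef (cvec - h) (sRef h Λ) = T h Λ := by
  have key : form (cvec - h) (sRef h Λ) = form cvec Λ + form h Λ := by
    simp only [sRef, form_sub_right, form_sub_left, form_smul_right, hh, hc]
    ring
  rw [sRef, key, T, hh, Int.ediv_self (by decide), one_mul, sRef]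
  module

theorem cvec_eq_sum :
    cvec = (3 : ℤ) • ee 0 - ∑ x ∈ ({1, 2, 3, 4, 5, 6, 7, 8, 9} : Finset (Fin 10)), ee x := by
  decide

theorem form_cvec_ee {i : Fin 10} (hi : i ≠ 0) : form cvec (ee i) = -1 := by
  revert i
  decide

theorem form_cvec_ee_zero : form cvec (ee 0) = -3 := by decide

/-- A list of nine indices exhausting `{1, …, 9}` has no repetitions. -/
theorem nodup_of_toFinset_eq {l : List (Fin 10)} (hl : l.length = 9)
    (h : l.toFinset = {1, 2, 3, 4, 5, 6, 7, 8, 9}) : l.Nodup := by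
  rw [← Multiset.coe_nodup, ← Multiset.toFinset_card_eq_card_iff_nodup]
  simp only [Multiset.coe_card, hl]
  exact (congrArg Finset.card h).trans (by decide)

theorem ne_zero_of_toFinset_eq {l : List (Fin 10)}
    (h : l.toFinset = {1, 2, 3, 4, 5, 6, 7, 8, 9}) : ∀ x ∈ l, x ≠ 0 := by
  rintro x hx rfl
  rw [← List.mem_toFinset, h] at hx
  revert hx
  decide

theorem cvec_eq_of_toFinset_eq {l : List (Fin 10)} (hl : l.length = 9)
    (h : l.toFinset = {1, 2, 3, 4, 5, 6, 7, 8, 9}) :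
    cvec = (3 : ℤ) • ee 0 - (l.map ee).sum := by
  rw [cvec_eq_sum, ← h, List.sum_toFinset _ (nodup_of_toFinset_eq hl h)]

theorem form_eijk_self {i j k : Fin 10} (hi : i ≠ 0) (hj : j ≠ 0) (hk : k ≠ 0)
    (hij : i ≠ j) (hik : i ≠ k) (hjk : j ≠ k) : form (eijk i j k) (eijk i j k) = 2 := by
  simp [eijk, form_sub_left, form_sub_right, form_ee, hi, hj, hk, hi.symm, hj.symm, hk.symm,
    hij, hik, hjk, hij.symm, hik.symm, hjk.symm]

theorem form_cvec_eijk {i j k : Fin 10} (hi : i ≠ 0) (hj : j ≠ 0) (hk : k ≠ 0) :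
    form cvec (eijk i j k) = 0 := by
  simp [eijk, form_sub_right, form_cvec_ee, form_cvec_ee_zero, hi, hj, hk]

theorem form_eij_self {i j : Fin 10} (hi : i ≠ 0) (hj : j ≠ 0) (hij : i ≠ j) :
    form (eij i j) (eij i j) = 2 := by
  simp [eij, form_sub_left, form_sub_right, form_ee, hi, hj, hij, hij.symm]

theorem form_cvec_eij {i j : Fin 10} (hi : i ≠ 0) (hj : j ≠ 0) : form cvec (eij i j) = 0 := by
  simp [eij, form_sub_right, form_cvec_ee, hi, hj]

/-- The explicit expressions of the translations `T_{ij}` and `T_{ijk}` as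
compositions of reflections:
`T_{ij} = s_{il₁l₂} s_{il₃l₄} s_{l₅l₆l₇} s_{il₃l₄} s_{il₁l₂} s_{ij}` and
`T_{ijk} = s_{l₁l₂l₃} s_{l₄l₅l₆} s_{l₁l₂l₃} s_{ijk}`. -/
theorem translations_as_reflections :
    (∀ i j l1 l2 l3 l4 l5 l6 l7 : Fin 10,
      ({i, j, l1, l2, l3, l4, l5, l6, l7} : Finset (Fin 10)) =
        ({1, 2, 3, 4, 5, 6, 7, 8, 9} : Finset (Fin 10)) →
      ∀ Λ : Fin 10 → ℤ,
        sRef (eijk i l1 l2) (sRef (eijk i l3 l4) (sRef (eijk l5 l6 l7)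
          (sRef (eijk i l3 l4) (sRef (eijk i l1 l2) (sRef (eij i j) Λ))))) =
          T (eij i j) Λ) ∧
    (∀ i j k l1 l2 l3 l4 l5 l6 : Fin 10,
      ({i, j, k, l1, l2, l3, l4, l5, l6} : Finset (Fin 10)) =
        ({1, 2, 3, 4, 5, 6, 7, 8, 9} : Finset (Fin 10)) →
      ∀ Λ : Fin 10 → ℤ,
        sRef (eijk l1 l2 l3) (sRef (eijk l4 l5 l6) (sRef (eijk l1 l2 l3)
          (sRef (eijk i j k) Λ))) = T (eijk i j k) Λ) := by
  constructor
  · intro i j l1 l2 l3 l4 l5 l6 l7 h Λ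
    have hl : [i, j, l1, l2, l3, l4, l5, l6, l7].toFinset = {1, 2, 3, 4, 5, 6, 7, 8, 9} := by
      simpa using h
    have hd := nodup_of_toFinset_eq rfl hl
    have h0 := ne_zero_of_toFinset_eq hl
    have hc := cvec_eq_of_toFinset_eq rfl hl
    simp only [List.nodup_cons, List.mem_cons, List.not_mem_nil, not_or, or_false,
      forall_eq_or_imp, forall_eq, List.map_cons, List.map_nil, List.sum_cons, List.sum_nil]
      at hd h0 hc
    have h1 : form (eijk i l3 l4) (eijk l5 l6 l7) = -1 := by
      simp only [eijk, form_sub_left, form_sub_right, form_ee]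
      grind
    have h2 : form (eijk i l1 l2) (eijk i l3 l4 + eijk l5 l6 l7) = -1 := by
      rw [form_comm, form_add_left]
      simp only [eijk, form_sub_left, form_sub_right, form_ee]
      grind
    have h3 : eijk i l1 l2 + (eijk i l3 l4 + eijk l5 l6 l7) = cvec - eij i j := by
      rw [hc]
      simp only [eijk, eij]
      module
    rw [sRef_conj (form_eijk_self (by tauto) (by tauto) (by tauto) (by tauto) (by tauto)
      (by tauto)), sRef_conj (form_eijk_self (by tauto) (by tauto) (by tauto) (by tauto)
      (by tauto) (by tauto)), sRef_eq_add h1, sRef_eq_add h2, h3]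
    exact sRef_cvec_sub (form_eij_self (by tauto) (by tauto) (by tauto))
      (form_cvec_eij (by tauto) (by tauto)) Λ
  · intro i j k l1 l2 l3 l4 l5 l6 h Λ
    have hl : [i, j, k, l1, l2, l3, l4, l5, l6].toFinset = {1, 2, 3, 4, 5, 6, 7, 8, 9} := by
      simpa using h
    have hd := nodup_of_toFinset_eq rfl hl
    have h0 := ne_zero_of_toFinset_eq hl
    have hc := cvec_eq_of_toFinset_eq rfl hl
    simp only [List.nodup_cons, List.mem_cons, List.not_mem_nil, not_or, or_false,
      forall_eq_or_imp, forall_eq, List.map_cons, List.map_nil, List.sum_cons, List.sum_nil]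
      at hd h0 hc
    have h1 : form (eijk l1 l2 l3) (eijk l4 l5 l6) = -1 := by
      simp only [eijk, form_sub_left, form_sub_right, form_ee]
      grind
    have h2 : eijk l1 l2 l3 + eijk l4 l5 l6 = cvec - eijk i j k := by
      rw [hc]
      simp only [eijk]
      module
    rw [sRef_conj (form_eijk_self (by tauto) (by tauto) (by tauto) (by tauto) (by tauto)
      (by tauto)), sRef_eq_add h1, h2]
    exact sRef_cvec_sub (form_eijk_self (by tauto) (by tauto) (by tauto) (by tauto) (by tauto)
      (by tauto)) (form_cvec_eijk (by tauto) (by tauto) (by tauto)) Λ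
end
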